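/- For every real number p there exists a constant C = C(p) such that for all nonzero integers k and k′, all integers l and l′, all real numbers η and ξ, and every real t ≥ 1, one has (|k| + |η − kt| + |l|) · (|k| + |ξ − k′t| + |l′|) / (k′² + l′² + (ξ − k′t)²) · ⟨t/⟨ξ,l′⟩⟩^p ≤ C · (⟨t⟩ + ⟨t/⟨ξ,l′⟩⟩^p) · ⟨k − k′, η − ξ, l − l′⟩². -/

import Mathlib

/-- Japanese bracket `⟨a⟩ = √(1 + a²)`. -/
noncomputable def jap (a : ℝ) : ℝ := Real.sqrt (1 + a ^ 2)

/-- Japanese bracket of a pair (ℓ¹ convention): `⟨a,b⟩ = √(1 + (|a| + |b|)²)`. -/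
noncomputable def jap2 (a b : ℝ) : ℝ := Real.sqrt (1 + (|a| + |b|) ^ 2)

/-- Japanese bracket of a triple (ℓ¹ convention): `⟨a,b,c⟩ = √(1 + (|a| + |b| + |c|)²)`. -/
noncomputable def jap3 (a b c : ℝ) : ℝ := Real.sqrt (1 + (|a| + |b| + |c|) ^ 2)

theorem sq_add_three_le (a b c : ℝ) :
    (|a| + |b| + |c|) ^ 2 ≤ 3 * (a ^ 2 + b ^ 2 + c ^ 2) := by
  rw [← sq_abs a, ← sq_abs b, ← sq_abs c]
  nlinarith [sq_nonneg (|a| - |b|), sq_nonneg (|b| - |c|), sq_nonneg (|a| - |c|)]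

theorem one_add_sq_le_jap3 (a b c : ℝ) :
    (1 + (|a| + |b| + |c|)) ^ 2 ≤ 2 * jap3 a b c ^ 2 := by
  rw [jap3, Real.sq_sqrt (by positivity)]
  nlinarith [sq_nonneg (1 - (|a| + |b| + |c|))]

theorem le_jap (a : ℝ) : a ≤ jap a :=
  Real.le_sqrt_of_sq_le (by linarith)

theorem one_le_jap (a : ℝ) : 1 ≤ jap a :=
  Real.one_le_sqrt.mpr (by nlinarith [sq_nonneg a])

theorem abs_le_jap2 (a b : ℝ) : |a| ≤ jap2 a b :=
  Real.le_sqrt_of_sq_le (by nlinarith [abs_nonneg a, abs_nonneg b])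

theorem jap2_pos (a b : ℝ) : 0 < jap2 a b :=
  Real.sqrt_pos.mpr (by positivity)

/-- The multiplier, cleared of its denominator, in terms of the time and the size of the
low-frequency symbol. -/
theorem symbol_mul_le (k k' l l' η ξ t : ℝ) (ht : 0 ≤ t) (hk' : 1 ≤ |k'|) :
    (|k| + |η - k * t| + |l|) * (|k| + |ξ - k' * t| + |l'|) ≤
      (1 + (|k - k'| + |η - ξ| + |l - l'|)) ^ 2 *
        ((|k'| + |l'| + |ξ - k' * t|) + t) * (|k'| + |l'| + |ξ - k' * t|) := by
  have hk : |k| ≤ |k'| + |k - k'| := by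
    simpa using abs_add_le k' (k - k')
  have hl : |l| ≤ |l'| + |l - l'| := by
    simpa using abs_add_le l' (l - l')
  have hη : |η - k * t| ≤ |ξ - k' * t| + |η - ξ| + |k - k'| * t := by
    have h := abs_add_three (ξ - k' * t) (η - ξ) (-((k - k') * t))
    rw [abs_neg, abs_mul, abs_of_nonneg ht] at h
    rwa [show η - k * t = ξ - k' * t + (η - ξ) + -((k - k') * t) by ring]
  have ha := abs_nonneg (k - k')
  have hb := abs_nonneg (η - ξ)
  have hc := abs_nonneg (l - l')
  have hL := abs_nonneg l'
  have hX := abs_nonneg (ξ - k' * t)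
  set a := |k - k'|
  set b := |η - ξ|
  set c := |l - l'|
  set M := |k'| + |l'| + |ξ - k' * t| with hM
  have hM1 : 1 ≤ M := by linarith
  have hA : |k| + |η - k * t| + |l| ≤ (1 + (a + b + c)) * (M + t) := by
    nlinarith [mul_nonneg (add_nonneg (add_nonneg ha hb) hc) (sub_nonneg.mpr hM1),
      mul_nonneg hb ht, mul_nonneg hc ht]
  have hB : |k| + |ξ - k' * t| + |l'| ≤ (1 + (a + b + c)) * M := by
    nlinarith [mul_nonneg (add_nonneg (add_nonneg ha hb) hc) (sub_nonneg.mpr hM1)]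
  calc _ ≤ ((1 + (a + b + c)) * (M + t)) * ((1 + (a + b + c)) * M) := by gcongr
    _ = _ := by ring

/-- Either the frequency is non-resonant, or the time is comparable to the frequency. -/
theorem le_two_mul_or_jap_rpow_le (p k' l' ξ t : ℝ) (ht : 0 ≤ t) (hk' : 1 ≤ |k'|) :
    t ≤ 2 * |ξ - k' * t| ∨ jap (t / jap2 ξ l') ^ p ≤ 3 ^ |p| := by
  rcases le_total (2 * jap2 ξ l') t with h | h
  · left
    have h1 := abs_sub_abs_le_abs_sub (k' * t) ξ
    rw [abs_mul, abs_of_nonneg ht, abs_sub_comm] at h1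
    nlinarith [abs_le_jap2 ξ l']
  · right
    have hr : t / jap2 ξ l' ≤ 2 := (div_le_iff₀ (jap2_pos ξ l')).mpr h
    have hr0 : 0 ≤ t / jap2 ξ l' := div_nonneg ht (jap2_pos ξ l').le
    have hj : jap (t / jap2 ξ l') ≤ 3 := by
      rw [jap]
      exact Real.sqrt_le_iff.mpr ⟨by norm_num, by nlinarith⟩
    calc jap (t / jap2 ξ l') ^ p ≤ jap (t / jap2 ξ l') ^ |p| :=
          Real.rpow_le_rpow_of_exponent_le (one_le_jap _) (le_abs_self p)
      _ ≤ 3 ^ |p| :=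
          Real.rpow_le_rpow (zero_le_one.trans (one_le_jap _)) hj (abs_nonneg p)

/-- Multiplier inequality controlling 3D echo-type interactions: for every real `p` there is
`C = C(p)` so that for all nonzero `k, k′`, all `l, l′`, all `η, ξ` and `t ≥ 1`,
`(|k|+|η−kt|+|l|)(|k|+|ξ−k′t|+|l′|)/(k′²+l′²+(ξ−k′t)²)·⟨t/⟨ξ,l′⟩⟩^p ≤
 C(⟨t⟩ + ⟨t/⟨ξ,l′⟩⟩^p)⟨k−k′, η−ξ, l−l′⟩²`. -/
theorem echo_multiplier_inequality (p : ℝ) :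
    ∃ C : ℝ, 0 < C ∧
      ∀ (k k' : ℤ), k ≠ 0 → k' ≠ 0 → ∀ (l l' : ℤ) (η ξ : ℝ) (t : ℝ), 1 ≤ t →
        (|(k : ℝ)| + |η - k * t| + |(l : ℝ)|) * (|(k : ℝ)| + |ξ - k' * t| + |(l' : ℝ)|) /
            ((k' : ℝ) ^ 2 + (l' : ℝ) ^ 2 + (ξ - k' * t) ^ 2) *
            jap (t / jap2 ξ (l' : ℝ)) ^ p ≤
          C * (jap t + jap (t / jap2 ξ (l' : ℝ)) ^ p) *
            jap3 ((k : ℝ) - (k' : ℝ)) (η - ξ) ((l : ℝ) - (l' : ℝ)) ^ 2 := by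
  have hK : (0 : ℝ) < 3 ^ |p| := by positivity
  refine ⟨18 + 6 * 3 ^ |p|, by positivity, ?_⟩
  intro k k' _ hk' l l' η ξ t ht
  have ht0 : 0 ≤ t := by linarith
  have hk1 : (1 : ℝ) ≤ |(k' : ℝ)| := by
    exact_mod_cast Int.one_le_abs hk'
  have hsym := symbol_mul_le k k' l l' η ξ t ht0 hk1
  have hσ := one_add_sq_le_jap3 ((k : ℝ) - k') (η - ξ) ((l : ℝ) - l')
  have hQ := sq_add_three_le (k' : ℝ) l' (ξ - k' * t)
  have hcase := le_two_mul_or_jap_rpow_le p k' l' ξ t ht0 hk1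
  have hY : 0 < jap (t / jap2 ξ (l' : ℝ)) ^ p :=
    Real.rpow_pos_of_pos (zero_lt_one.trans_le (one_le_jap _)) p
  have htT := le_jap t
  have hM1 : 1 ≤ |(k' : ℝ)| + |(l' : ℝ)| + |ξ - k' * t| := by
    linarith [abs_nonneg (l' : ℝ), abs_nonneg (ξ - k' * t)]
  have hXM : |ξ - k' * t| ≤ |(k' : ℝ)| + |(l' : ℝ)| + |ξ - k' * t| := by
    linarith [abs_nonneg (l' : ℝ)]
  set Y := jap (t / jap2 ξ (l' : ℝ)) ^ p
  set J := jap3 ((k : ℝ) - k') (η - ξ) ((l : ℝ) - l') ^ 2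
  set M := |(k' : ℝ)| + |(l' : ℝ)| + |ξ - k' * t|
  set Q := (k' : ℝ) ^ 2 + (l' : ℝ) ^ 2 + (ξ - k' * t) ^ 2
  set S := (1 + (|(k : ℝ) - k'| + |η - ξ| + |(l : ℝ) - l'|)) ^ 2
  have hS : 0 ≤ S := sq_nonneg _
  have hQ0 : 0 < Q := by nlinarith
  have hJ : 0 ≤ J := sq_nonneg _
  have bound : ∀ r : ℝ, 0 ≤ r → M + t ≤ r * M →
      (|(k : ℝ)| + |η - k * t| + |(l : ℝ)|) * (|(k : ℝ)| + |ξ - k' * t| + |(l' : ℝ)|) / Q ≤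
        6 * r * J := by
    intro r hr hMr
    rw [div_le_iff₀ hQ0]
    calc _ ≤ S * (M + t) * M := hsym
      _ ≤ S * (r * M) * M := by gcongr
      _ = r * S * M ^ 2 := by ring
      _ ≤ r * (2 * J) * (3 * Q) := by gcongr
      _ = 6 * r * J * Q := by ring
  rcases hcase with h | h
  · calc _ ≤ 6 * 3 * J * Y := by
          gcongr
          exact bound 3 (by norm_num) (by linarith)
      _ = 18 * Y * J := by ring
      _ ≤ _ := by
          gcongr
          · linarith
          · linarith
  · calc _ ≤ 6 * (1 + t) * J * Y := by
          gcongr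
          exact bound (1 + t) (by linarith) (by nlinarith)
      _ = (6 * Y + 6 * (t * Y)) * J := by ring
      _ ≤ (6 * Y + 6 * (jap t * 3 ^ |p|)) * J := by gcongr; linarith
      _ ≤ _ := by
          gcongr
          nlinarith [mul_pos hK hY]
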